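/- Let X be a real vector space with a quasi-norm ‖·‖ with modulus of concavity α ≥ 1, complete with respect to ‖·‖, equipped with a semi-normalized Markushevich basis (e_i, e*_i) with c := sup_i (1+‖e_i‖)(1+‖e*_i‖) < ∞. Let t ∈ (0,1] and n = (n_k) a strictly increasing sequence of positive integers. The following are equivalent: (i) there is C₁ > 0 such that ‖P_A(x)‖ ≤ C₁·‖x‖ for every x ∈ X and every t-greedy set A for x with |A| ∈ {n_k}; (ii) there is C₂ > 0 such that ‖P_A(x)‖ ≤ C₂·‖x‖ for every finitely supported x ∈ X and every t-greedy set A for x with |A| ∈ {n_k}; (iii) there are m ∈ ℕ and C₃ > 0 such that ‖P_A(x)‖ ≤ C₃·‖x‖ for every finitely supported x ∈ X with supp(x) ⊆ (m, ∞) and every t-greedy set A for x with |A| ∈ {n_k}; (iv) for each x ∈ X there is C₄(x) > 0 such that ‖P_A(x)‖ ≤ C₄(x) for every t-greedy set A for x with |A| ∈ {n_k}; (v) for every x ∈ X and every sequence (A_k) with A_k a t-greedy set for x of cardinality n_k, ‖x − P_{A_k}(x)‖ → 0 as k → ∞. -/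

import Mathlib

open Finset

/-- Coordinate projection `P_A x = ∑_{i ∈ A} e*_i(x) • e_i`. -/
def qproj {X : Type*} [AddCommGroup X] [Module ℝ X]
    (e : ℕ → X) (f : ℕ → X →ₗ[ℝ] ℝ) (A : Finset ℕ) (x : X) : X :=
  ∑ i ∈ A, f i x • e i

/-- `A` is a `t`-greedy set for `x`:
`min_{i ∈ A} |e*_i(x)| ≥ t · sup_{j ∉ A} |e*_j(x)|`. -/
def qGreedySet {X : Type*} [AddCommGroup X] [Module ℝ X]
    (f : ℕ → X →ₗ[ℝ] ℝ) (t : ℝ) (x : X) (A : Finset ℕ) : Prop :=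
  ∀ i ∈ A, ∀ j ∉ A, t * |f j x| ≤ |f i x|

structure QB {X : Type*} [AddCommGroup X] [Module ℝ X] (q : X → ℝ) (α : ℝ)
    (e : ℕ → X) (f : ℕ → X →ₗ[ℝ] ℝ) (c : ℝ) : Prop where
  hα : 1 ≤ α
  hq0 : ∀ x : X, 0 ≤ q x
  hqs : ∀ (a : ℝ) (x : X), q (a • x) = |a| * q x
  hqa : ∀ x y : X, q (x + y) ≤ α * (q x + q y)
  hfc : ∀ (i : ℕ) (x : X), |f i x| ≤ c * q x
  hec : ∀ i, q (e i) ≤ c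
  hc1 : 1 ≤ c
  hbio : ∀ k i, f k (e i) = if k = i then 1 else 0
  hdense : ∀ x : X, ∀ ε : ℝ, 0 < ε →
      ∃ y ∈ Submodule.span ℝ (Set.range e), q (x - y) ≤ ε

namespace QB

variable {X : Type*} [AddCommGroup X] [Module ℝ X] {q : X → ℝ} {α : ℝ}
    {e : ℕ → X} {f : ℕ → X →ₗ[ℝ] ℝ} {c : ℝ}

lemma q_zero (h : QB q α e f c) : q 0 = 0 := by
  have := h.hqs 0 0
  simpa using this

lemma q_neg (h : QB q α e f c) (x : X) : q (-x) = q x := by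
  have := h.hqs (-1) x
  simpa using this

lemma q_sub (h : QB q α e f c) (x y : X) : q (x - y) ≤ α * (q x + q y) := by
  rw [sub_eq_add_neg, ← h.q_neg y]
  exact h.hqa _ _

lemma f_sum (h : QB q α e f c) (a : ℕ → ℝ) (A : Finset ℕ) (k : ℕ) :
    f k (∑ i ∈ A, a i • e i) = if k ∈ A then a k else 0 := by
  simp [map_sum, h.hbio]

lemma f_proj (h : QB q α e f c) (x : X) (A : Finset ℕ) (k : ℕ) :
    f k (qproj e f A x) = if k ∈ A then f k x else 0 :=
  h.f_sum _ A k

lemma proj_add (A : Finset ℕ) (x y : X) :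
    qproj e f A (x + y) = qproj e f A x + qproj e f A y := by
  simp [qproj, add_smul, Finset.sum_add_distrib]

lemma proj_sub (A : Finset ℕ) (x y : X) :
    qproj e f A (x - y) = qproj e f A x - qproj e f A y := by
  simp [qproj, sub_smul, Finset.sum_sub_distrib]

lemma proj_smul (A : Finset ℕ) (a : ℝ) (x : X) :
    qproj e f A (a • x) = a • qproj e f A x := by
  simp [qproj, mul_smul, Finset.smul_sum]

lemma proj_congr (A : Finset ℕ) (x y : X) (hxy : ∀ i ∈ A, f i x = f i y) :
    qproj e f A x = qproj e f A y :=
  Finset.sum_congr rfl fun i hi => by rw [hxy i hi]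

lemma proj_zero (A : Finset ℕ) (x : X) (hxy : ∀ i ∈ A, f i x = 0) :
    qproj e f A x = 0 :=
  Finset.sum_eq_zero fun i hi => by rw [hxy i hi, zero_smul]

lemma proj_mono (A B : Finset ℕ) (hAB : A ⊆ B) (x : X) (hx : ∀ i ∈ B, i ∉ A → f i x = 0) :
    qproj e f A x = qproj e f B x :=
  Finset.sum_subset hAB fun i hi hi' => by rw [hx i hi hi', zero_smul]

lemma sum_mem (a : ℕ → ℝ) (A : Finset ℕ) :
    ∑ i ∈ A, a i • e i ∈ Submodule.span ℝ (Set.range e) :=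
  Submodule.sum_mem _ fun i _ => Submodule.smul_mem _ _ (Submodule.subset_span ⟨i, rfl⟩)

lemma sum_bound (h : QB q α e f c) (a : ℕ → ℝ) (A : Finset ℕ) (b : ℝ) (hb : 0 ≤ b)
    (ha : ∀ i ∈ A, |a i| ≤ b) :
    q (∑ i ∈ A, a i • e i) ≤ A.card * α ^ A.card * c * b := by
  have hα := h.hα
  have hc := h.hc1
  induction A using Finset.induction_on with
  | empty => simp [h.q_zero]
  | insert k A hk ih =>
    rw [Finset.sum_insert hk, Finset.card_insert_of_notMem hk]
    have h1 := ih fun i hi => ha i (Finset.mem_insert_of_mem hi)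
    have h2 : q (a k • e k) ≤ b * c := by
      rw [h.hqs]
      exact mul_le_mul (ha k (Finset.mem_insert_self _ _)) (h.hec k) (h.hq0 _) hb
    have h3 : 1 ≤ α ^ A.card := one_le_pow₀ hα
    calc _ ≤ α * (b * c + A.card * α ^ A.card * c * b) := by
            refine (h.hqa _ _).trans ?_
            gcongr
      _ ≤ α * (α ^ A.card * (b * c) + A.card * α ^ A.card * c * b) := by
            have : 0 ≤ b * c := by positivity
            have h4 := le_mul_of_one_le_left this h3
            gcongr
      _ = _ := by push_cast; ring

lemma K_mono (h : QB q α e f c) {a b : ℕ} (hab : a ≤ b) :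
    (a : ℝ) * α ^ a * c * c ≤ b * α ^ b * c * c := by
  have hα := h.hα
  have hc := h.hc1
  gcongr

lemma proj_bound (h : QB q α e f c) (x : X) (A : Finset ℕ) :
    q (qproj e f A x) ≤ A.card * α ^ A.card * c * c * q x := by
  have hc := h.hc1
  have := h.sum_bound (fun i => f i x) A (c * q x)
    (mul_nonneg (by linarith) (h.hq0 x)) fun i _ => h.hfc i x
  rw [← mul_assoc] at this
  exact this

lemma span_supp (h : QB q α e f c) {y : X} (hy : y ∈ Submodule.span ℝ (Set.range e)) :
    ∃ F : Finset ℕ, (∀ i, i ∈ F ↔ f i y ≠ 0) ∧ qproj e f F y = y := by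
  rw [Finsupp.mem_span_range_iff_exists_finsupp] at hy
  obtain ⟨a, rfl⟩ := hy
  have h1 : ∀ k, f k (a.sum fun i r => r • e i) = a k := by
    intro k
    rw [Finsupp.sum, h.f_sum]
    by_cases hk : k ∈ a.support
    · simp [hk]
    · simp only [hk, if_false]
      simpa using (Finsupp.notMem_support_iff.mp hk).symm
  refine ⟨a.support, fun i => by rw [h1]; simp, ?_⟩
  rw [qproj]
  simp only [h1]
  rfl

lemma decay (h : QB q α e f c) (x : X) {η : ℝ} (hη : 0 < η) :
    ∃ S : Finset ℕ, ∀ i, i ∈ S ↔ η ≤ |f i x| := by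
  have hc := h.hc1
  obtain ⟨y, hy, hxy⟩ := h.hdense x (η / (2 * c)) (by positivity)
  obtain ⟨F, hF, -⟩ := h.span_supp hy
  refine ⟨F.filter fun i => η ≤ |f i x|, fun i => ?_⟩
  rw [Finset.mem_filter]
  refine ⟨fun hi => hi.2, fun hi => ⟨?_, hi⟩⟩
  rw [hF]
  intro h0
  have h1 := h.hfc i (x - y)
  rw [map_sub, h0, sub_zero] at h1
  have h2 : c * q (x - y) ≤ c * (η / (2 * c)) := by gcongr
  have h3 : c * (η / (2 * c)) = η / 2 := by field_simp
  linarith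

lemma extend_one (h : QB q α e f c) {t : ℝ} (ht0 : 0 < t) (ht1 : t ≤ 1) (x : X) (A : Finset ℕ)
    (hA : qGreedySet f t x A) : ∃ a, a ∉ A ∧ qGreedySet f t x (insert a A) := by
  have key : ∃ a, a ∉ A ∧ ∀ j ∉ A, |f j x| ≤ |f a x| := by
    by_cases h0 : ∀ j ∉ A, f j x = 0
    · obtain ⟨a, ha⟩ := Infinite.exists_notMem_finset A
      refine ⟨a, ha, fun j hj => ?_⟩
      rw [h0 j hj, h0 a ha]
    · push Not at h0
      obtain ⟨b, hb, hb0⟩ := h0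
      obtain ⟨S, hS⟩ := h.decay x (abs_pos.mpr hb0)
      have hne : (S \ A).Nonempty := ⟨b, by simp [hS, hb]⟩
      obtain ⟨a, ha, hmax⟩ := Finset.exists_max_image (S \ A) (fun i => |f i x|) hne
      rw [Finset.mem_sdiff] at ha
      refine ⟨a, ha.2, fun j hj => ?_⟩
      by_cases hjS : j ∈ S
      · exact hmax j (by simp [hjS, hj])
      · rw [hS] at hjS
        have := hmax b (by simp [hS, hb])
        linarith
  obtain ⟨a, ha, hm⟩ := key
  refine ⟨a, ha, fun i hi j hj => ?_⟩
  rw [Finset.mem_insert, not_or] at hj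
  rw [Finset.mem_insert] at hi
  rcases hi with rfl | hi
  · have := hm j hj.2
    nlinarith [abs_nonneg (f j x)]
  · exact hA i hi j hj.2

lemma extend (h : QB q α e f c) {t : ℝ} (ht0 : 0 < t) (ht1 : t ≤ 1) (x : X) (A : Finset ℕ)
    (hA : qGreedySet f t x A) (d : ℕ) :
    ∃ D, Disjoint A D ∧ D.card = d ∧ qGreedySet f t x (A ∪ D) := by
  induction d with
  | zero => exact ⟨∅, by simp, rfl, by simpa using hA⟩
  | succ d ih =>
    obtain ⟨D, h1, h2, h3⟩ := ih
    obtain ⟨a, ha, hg⟩ := h.extend_one ht0 ht1 x _ h3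
    rw [Finset.mem_union, not_or] at ha
    refine ⟨insert a D, ?_, ?_, ?_⟩
    · rw [Finset.disjoint_insert_right]
      exact ⟨ha.1, h1⟩
    · rw [Finset.card_insert_of_notMem ha.2, h2]
    · rwa [Finset.union_insert]

lemma small_subset (x : X) (A : Finset ℕ) (d : ℕ) (hd : d ≤ A.card) :
    ∃ L ⊆ A, L.card = d ∧ ∀ l ∈ L, ∀ i ∈ A, i ∉ L → |f l x| ≤ |f i x| := by
  induction d with
  | zero => exact ⟨∅, by simp, rfl, by simp⟩
  | succ d ih =>
    obtain ⟨L, h1, h2, h3⟩ := ih (by omega)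
    have hne : (A \ L).Nonempty := by
      rw [← Finset.card_pos, Finset.card_sdiff_of_subset h1]
      omega
    obtain ⟨a, ha, hmin⟩ := Finset.exists_min_image (A \ L) (fun i => |f i x|) hne
    rw [Finset.mem_sdiff] at ha
    refine ⟨insert a L, Finset.insert_subset ha.1 h1, ?_, ?_⟩
    · rw [Finset.card_insert_of_notMem ha.2, h2]
    · intro l hl i hi hil
      rw [Finset.mem_insert, not_or] at hil
      rw [Finset.mem_insert] at hl
      rcases hl with rfl | hl
      · exact hmin i (by simp [hi, hil.2])
      · exact h3 l hl i hi hil.2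

lemma perturb (h : QB q α e f c) (u : X) (B : Finset ℕ) {η : ℝ} (hη : 0 < η) :
    ∃ v ∈ Submodule.span ℝ (Set.range e), (∀ i ∉ B, f i v = 0) ∧
      (∀ i ∈ B, |f i (u + v)| = |f i u| + η) ∧ q v ≤ B.card * α ^ B.card * c * η ∧
      qproj e f B v = v := by
  have hf := h.f_sum (fun i => if 0 ≤ f i u then η else -η) B
  refine ⟨∑ i ∈ B, (if 0 ≤ f i u then η else -η) • e i, sum_mem _ _, ?_, ?_, ?_, ?_⟩
  · intro i hi
    rw [hf, if_neg hi]
  · intro i hi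
    rw [map_add, hf, if_pos hi]
    split_ifs with h0
    · rw [abs_of_nonneg h0, abs_of_nonneg (by linarith)]
    · push Not at h0
      rw [abs_of_neg h0, abs_of_neg (by linarith)]; ring
  · apply h.sum_bound _ _ _ hη.le
    intro i _
    split_ifs <;> simp [abs_of_pos hη]
  · rw [qproj]
    refine Finset.sum_congr rfl fun i hi => ?_
    rw [hf, if_pos hi]

lemma exists_eta (F : Finset ℕ) (x : X) (hF : ∀ i ∈ F, f i x ≠ 0) :
    ∃ η : ℝ, 0 < η ∧ ∀ i ∈ F, η ≤ |f i x| := by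
  induction F using Finset.induction_on with
  | empty => exact ⟨1, one_pos, by simp⟩
  | insert k F hk ih =>
    obtain ⟨η, h0, h1⟩ := ih fun i hi => hF i (Finset.mem_insert_of_mem hi)
    refine ⟨min η |f k x|, lt_min h0 (abs_pos.mpr (hF k (Finset.mem_insert_self _ _))), ?_⟩
    intro i hi
    rw [Finset.mem_insert] at hi
    rcases hi with rfl | hi
    · exact min_le_right _ _
    · exact (min_le_left _ _).trans (h1 i hi)

/-- small multiplier -/
lemma exists_small (K ε : ℝ) (hK : 0 ≤ K) (hε : 0 < ε) : ∃ η : ℝ, 0 < η ∧ K * η ≤ ε := by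
  refine ⟨ε / (K + 1), by positivity, ?_⟩
  rw [mul_div_assoc', div_le_iff₀ (by positivity)]
  nlinarith

lemma K_nonneg (h : QB q α e f c) (d : ℕ) : 0 ≤ (d : ℝ) * α ^ d * c := by
  have hα := h.hα
  have hc := h.hc1
  positivity

/-- (ii) → (i) -/
lemma two_one (h : QB q α e f c) {t : ℝ} (ht0 : 0 < t) (ht1 : t ≤ 1) (n : ℕ → ℕ)
    (H : ∃ C₂ : ℝ, 0 < C₂ ∧ ∀ x ∈ Submodule.span ℝ (Set.range e), ∀ A : Finset ℕ,
        qGreedySet f t x A → (∃ k, A.card = n k) → q (qproj e f A x) ≤ C₂ * q x) :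
    ∃ C₁ : ℝ, 0 < C₁ ∧ ∀ (x : X) (A : Finset ℕ), qGreedySet f t x A →
        (∃ k, A.card = n k) → q (qproj e f A x) ≤ C₁ * q x := by
  obtain ⟨C, hC, H⟩ := H
  have hα := h.hα
  have hc := h.hc1
  refine ⟨α * C * α, by positivity, fun x A hA hk => ?_⟩
  set K := (A.card : ℝ) * α ^ A.card * c with hKdef
  have hK : 0 ≤ K := h.K_nonneg _
  -- total error constant
  set R := α * (C * α * (α * (1 + α * (K * c + K * c))) + K * c) with hR
  have hR0 : 0 ≤ R := by positivity
  refine le_of_forall_pos_le_add fun ε hε => ?_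
  obtain ⟨δ, hδ, hδε⟩ := exists_small R ε hR0 hε
  obtain ⟨y, hy, hxy⟩ := h.hdense x δ hδ
  set y' := y + qproj e f A (x - y) with hy'
  have hcd : 0 < c * δ := by positivity
  obtain ⟨v, hv, hv0, hvA, hvq, hvP⟩ := h.perturb y' A hcd
  have hfA : ∀ i ∈ A, f i y' = f i x := by
    intro i hi
    rw [hy', map_add, h.f_proj, if_pos hi, map_sub]; ring
  have hfnA : ∀ i ∉ A, f i (y' + v) = f i y := by
    intro i hi
    rw [map_add, hv0 i hi, hy', map_add, h.f_proj, if_neg hi]; ring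
  have hg : qGreedySet f t (y' + v) A := by
    intro i hi j hj
    rw [hvA i hi, hfA i hi, hfnA j hj]
    have h1 := hA i hi j hj
    have h2 := h.hfc j (x - y)
    rw [map_sub] at h2
    have h3 : c * q (x - y) ≤ c * δ := by gcongr
    have h4 : |f j y| ≤ |f j x| + c * δ := by
      have := abs_sub_abs_le_abs_sub (f j y) (f j x)
      rw [abs_sub_comm] at this
      linarith
    nlinarith
  have h1 := H (y' + v) (Submodule.add_mem _ (Submodule.add_mem _ hy (sum_mem _ _)) hv) A hg hk
  have hP : qproj e f A x = qproj e f A (y' + v) - v := by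
    rw [proj_add, hvP, proj_congr A y' x hfA]; simp
  have hvq' : q v ≤ K * (c * δ) := hvq
  have h2 : q (qproj e f A (x - y)) ≤ K * c * δ := by
    refine (h.proj_bound _ _).trans ?_
    rw [← hKdef]; gcongr
  have hw : y' + v = x + (-(x - y) + (qproj e f A (x - y) + v)) := by rw [hy']; abel
  have h3 : q (y' + v) ≤ α * (q x + α * (δ + α * (K * c * δ + K * (c * δ)))) := by
    rw [hw]
    refine (h.hqa _ _).trans ?_
    gcongr
    refine (h.hqa _ _).trans ?_
    rw [h.q_neg]
    gcongr
    refine (h.hqa _ _).trans ?_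
    gcongr
  rw [hP]
  calc _ ≤ α * (C * (α * (q x + α * (δ + α * (K * c * δ + K * (c * δ))))) + K * (c * δ)) := by
        refine (h.q_sub _ _).trans ?_
        gcongr
        exact h1.trans (by gcongr)
    _ = α * C * α * q x + R * δ := by rw [hR]; ring
    _ ≤ _ := by linarith

/-- (iii) → (ii) -/
lemma three_two (h : QB q α e f c) {t : ℝ} (ht0 : 0 < t) (ht1 : t ≤ 1) (n : ℕ → ℕ)
    (H : ∃ (m : ℕ) (C₃ : ℝ), 0 < C₃ ∧
        ∀ x ∈ Submodule.span ℝ (Set.range e), (∀ i, f i x ≠ 0 → m < i) →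
          ∀ A : Finset ℕ, qGreedySet f t x A → (∃ k, A.card = n k) →
            q (qproj e f A x) ≤ C₃ * q x) :
    ∃ C₂ : ℝ, 0 < C₂ ∧ ∀ x ∈ Submodule.span ℝ (Set.range e), ∀ A : Finset ℕ,
        qGreedySet f t x A → (∃ k, A.card = n k) → q (qproj e f A x) ≤ C₂ * q x := by
  obtain ⟨m, C, hC, H⟩ := H
  have hα := h.hα
  have hc := h.hc1
  set K := ((m + 1 : ℕ) : ℝ) * α ^ (m + 1) * c * c with hKdef
  have hK : 0 ≤ K := by positivity
  refine ⟨α * (α * (C + K) * (α * (1 + K)) + K), by positivity, fun x hx A hA hk => ?_⟩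
  set B := Finset.range (m + 1) with hB
  have hPB : ∀ D : Finset ℕ, D.card ≤ m + 1 → ∀ z, q (qproj e f D z) ≤ K * q z := by
    intro D hD z
    refine (h.proj_bound _ _).trans ?_
    have := h.hq0 z
    have := h.K_mono hD
    gcongr
  set x' := x - qproj e f B x with hx'
  have hfB : ∀ i ∈ B, f i x' = 0 := by
    intro i hi
    rw [hx', map_sub, h.f_proj, if_pos hi, sub_self]
  have hfnB : ∀ i ∉ B, f i x' = f i x := by
    intro i hi
    rw [hx', map_sub, h.f_proj, if_neg hi, sub_zero]
  have hg : qGreedySet f t x' (A \ B) := by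
    intro i hi j hj
    rw [Finset.mem_sdiff] at hi hj
    by_cases hjB : j ∈ B
    · rw [hfB j hjB]; simp
    · rw [hfnB j hjB, hfnB i hi.2]
      exact hA i hi.1 j fun hjA => hj ⟨hjA, hjB⟩
  obtain ⟨D, hD1, hD2, hD3⟩ := h.extend ht0 ht1 x' _ hg (A ∩ B).card
  have hABc : (A ∩ B).card ≤ m + 1 := by
    refine (Finset.card_le_card Finset.inter_subset_right).trans ?_
    simp [hB]
  have hcard : ((A \ B) ∪ D).card = A.card := by
    rw [Finset.card_union_of_disjoint hD1, hD2, Finset.card_sdiff_add_card_inter]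
  have h1 := H x' (Submodule.sub_mem _ hx (sum_mem _ _)) (by
    intro i hi
    by_contra hmi
    exact hi (hfB i (by rw [hB, Finset.mem_range]; omega))) _ hD3 (by rw [hcard]; exact hk)
  have e1 : qproj e f (A \ B) x' = qproj e f ((A \ B) ∪ D) x' - qproj e f D x' := by
    simp only [qproj]
    rw [Finset.sum_union hD1]; abel
  have e2 : qproj e f A x = qproj e f (A \ B) x' + qproj e f (A ∩ B) x := by
    rw [proj_congr (A \ B) x' x fun i hi => hfnB i (Finset.mem_sdiff.mp hi).2]
    simp only [qproj]
    rw [← Finset.sum_union (Finset.disjoint_sdiff_inter A B), Finset.sdiff_union_inter]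
  have b1 : q x' ≤ α * (q x + K * q x) := by
    refine (h.q_sub _ _).trans ?_
    gcongr
    exact hPB B (by simp [hB]) x
  rw [e2]
  have hqx := h.hq0 x
  calc _ ≤ α * (q (qproj e f (A \ B) x') + K * q x) := by
        refine (h.hqa _ _).trans ?_
        gcongr
        exact hPB _ hABc x
    _ ≤ α * (α * (C * q x' + K * q x') + K * q x) := by
        gcongr
        rw [e1]
        refine (h.q_sub _ _).trans ?_
        gcongr
        exact hPB _ (hD2.trans_le hABc) x'
    _ ≤ α * (α * (C * (α * (q x + K * q x)) + K * (α * (q x + K * q x))) + K * q x) := by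
        gcongr
    _ = _ := by ring

/-- (i) → (v) -/
lemma one_five (h : QB q α e f c) {t : ℝ} (ht0 : 0 < t) (ht1 : t ≤ 1) (n : ℕ → ℕ)
    (hn : StrictMono n)
    (H : ∃ C₁ : ℝ, 0 < C₁ ∧ ∀ (x : X) (A : Finset ℕ), qGreedySet f t x A →
        (∃ k, A.card = n k) → q (qproj e f A x) ≤ C₁ * q x) :
    ∀ (x : X) (A : ℕ → Finset ℕ),
        (∀ k, qGreedySet f t x (A k) ∧ (A k).card = n k) →
        ∀ ε : ℝ, 0 < ε → ∃ K, ∀ k ≥ K, q (x - qproj e f (A k) x) ≤ ε := by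
  obtain ⟨C, hC, H⟩ := H
  have hα := h.hα
  have hc := h.hc1
  have step : ∀ (x : X) (ε : ℝ), 0 < ε → ∃ G : Finset ℕ, q (x - qproj e f G x) ≤ ε := by
    intro x ε hε
    obtain ⟨δ, hδ, hδε⟩ := exists_small (α * (1 + C) * (α * 2)) ε (by positivity) hε
    obtain ⟨y, hy, hxy⟩ := h.hdense x δ hδ
    obtain ⟨B, hB, hBy⟩ := h.span_supp hy
    obtain ⟨η, hη, hηδ⟩ := exists_small _ δ (h.K_nonneg B.card) hδ
    obtain ⟨v, hv, hv0, hvB, hvq, hvP⟩ := h.perturb (x - y) B hη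
    set u := x - y + v with hu
    obtain ⟨S, hS⟩ := h.decay u hη
    have hBS : B ⊆ S := by
      intro i hi
      rw [hS, hvB i hi]
      linarith [abs_nonneg (f i (x - y))]
    have hgS : qGreedySet f t u S := by
      intro i hi j hj
      rw [hS] at hi hj
      push Not at hj
      nlinarith [abs_nonneg (f j u)]
    have hcn : S.card ≤ n S.card := hn.id_le _
    obtain ⟨D, hD1, hD2, hD3⟩ := h.extend ht0 ht1 u S hgS (n S.card - S.card)
    have h1 := H u _ hD3 ⟨S.card, by
      rw [Finset.card_union_of_disjoint hD1, hD2]; omega⟩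
    refine ⟨S ∪ D, ?_⟩
    have hBG : B ⊆ S ∪ D := hBS.trans Finset.subset_union_left
    have ey : qproj e f (S ∪ D) y = y := by
      rw [← proj_mono B _ hBG y, hBy]
      intro i _ hi
      by_contra h0
      exact hi ((hB i).mpr h0)
    have ev : qproj e f (S ∪ D) v = v := by
      rw [← proj_mono B _ hBG v, hvP]
      intro i _ hi
      exact hv0 i hi
    have eq1 : x - qproj e f (S ∪ D) x = u - qproj e f (S ∪ D) u := by
      rw [hu, proj_add, proj_sub, ey, ev]; abel
    have hqu : q u ≤ α * (δ + δ) := by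
      refine (h.hqa _ _).trans ?_
      gcongr
      linarith
    rw [eq1]
    calc _ ≤ α * (q u + C * q u) := by
          refine (h.q_sub _ _).trans ?_
          gcongr
      _ = α * (1 + C) * q u := by ring
      _ ≤ α * (1 + C) * (α * (δ + δ)) := by gcongr
      _ = α * (1 + C) * (α * 2) * δ := by ring
      _ ≤ ε := hδε
  intro x A hA ε hε
  obtain ⟨δ, hδ, hδε⟩ := exists_small (α * (1 + C) * (α * 2)) ε (by positivity) hε
  obtain ⟨G, hG⟩ := step x δ hδ
  set B := G.filter fun i => f i x ≠ 0 with hB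
  have hGB : qproj e f B x = qproj e f G x := by
    apply proj_mono _ _ (Finset.filter_subset _ _)
    intro i hi hi'
    by_contra h0
    exact hi' (Finset.mem_filter.mpr ⟨hi, h0⟩)
  rw [← hGB] at hG
  obtain ⟨η₁, hη₁, hηx⟩ := exists_eta B x fun i hi => (Finset.mem_filter.mp hi).2
  obtain ⟨η₂, hη₂, hη₂δ⟩ := exists_small _ δ (h.K_nonneg B.card) hδ
  set η := min η₁ η₂ with hηdef
  have hη : 0 < η := lt_min hη₁ hη₂
  obtain ⟨v, hv, hv0, hvB, hvq, hvP⟩ := h.perturb (x - qproj e f B x) B hη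
  set w := x - qproj e f B x + v with hw
  have htη : 0 < t * η := by positivity
  obtain ⟨S, hS⟩ := h.decay x htη
  refine ⟨S.card + 1, fun k hk => ?_⟩
  have hcn : k ≤ n k := hn.id_le _
  have hsmall : ∀ j ∉ A k, |f j x| < η := by
    have : ∃ l ∈ A k, l ∉ S := by
      by_contra hcon
      push Not at hcon
      have := Finset.card_le_card (show A k ⊆ S from hcon)
      rw [(hA k).2] at this
      omega
    obtain ⟨l, hl, hlS⟩ := this
    rw [hS] at hlS
    push Not at hlS
    intro j hj
    have := (hA k).1 l hl j hj
    exact lt_of_mul_lt_mul_left (this.trans_lt hlS) ht0.le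
  have hBA : B ⊆ A k := by
    intro i hi
    by_contra hiA
    have h1 := hsmall i hiA
    have h2 := hηx i hi
    have h3 : η ≤ η₁ := min_le_left _ _
    linarith
  have hwnB : ∀ i ∉ B, f i w = f i x := by
    intro i hi
    rw [hw, map_add, hv0 i hi, map_sub, h.f_proj, if_neg hi]; ring
  have hg : qGreedySet f t w (A k) := by
    intro i hi j hj
    have hjB : j ∉ B := fun hjB => hj (hBA hjB)
    rw [hwnB j hjB]
    by_cases hiB : i ∈ B
    · rw [hvB i hiB]
      have := hsmall j hj
      nlinarith [abs_nonneg (f j x), abs_nonneg (f i (x - qproj e f B x))]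
    · rw [hwnB i hiB]
      exact (hA k).1 i hi j hj
  have h1 := H w _ hg ⟨k, (hA k).2⟩
  have ev : qproj e f (A k) v = v := by
    rw [← proj_mono B _ hBA v, hvP]
    intro i _ hi
    exact hv0 i hi
  have eP : qproj e f (A k) (qproj e f B x) = qproj e f B x := by
    rw [← proj_mono B _ hBA]
    · apply proj_congr
      intro i hi
      rw [h.f_proj, if_pos hi]
    · intro i _ hi
      rw [h.f_proj, if_neg hi]
  have eq1 : x - qproj e f (A k) x = w - qproj e f (A k) w := by
    rw [hw, proj_add, proj_sub, eP, ev]; abel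
  have hqw : q w ≤ α * (δ + δ) := by
    refine (h.hqa _ _).trans ?_
    gcongr
    refine hvq.trans (le_trans ?_ hη₂δ)
    have := h.K_nonneg B.card
    gcongr
    exact min_le_right _ _
  rw [eq1]
  calc _ ≤ α * (q w + C * q w) := by
        refine (h.q_sub _ _).trans ?_
        gcongr
    _ = α * (1 + C) * q w := by ring
    _ ≤ α * (1 + C) * (α * (δ + δ)) := by gcongr
    _ = α * (1 + C) * (α * 2) * δ := by ring
    _ ≤ ε := hδε

/-- (v) → (iv) -/
lemma five_four (h : QB q α e f c) {t : ℝ} (ht0 : 0 < t) (ht1 : t ≤ 1) (n : ℕ → ℕ)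
    (hn : StrictMono n)
    (H : ∀ (x : X) (A : ℕ → Finset ℕ),
        (∀ k, qGreedySet f t x (A k) ∧ (A k).card = n k) →
        ∀ ε : ℝ, 0 < ε → ∃ K, ∀ k ≥ K, q (x - qproj e f (A k) x) ≤ ε) :
    ∀ x : X, ∃ C₄ : ℝ, 0 < C₄ ∧ ∀ A : Finset ℕ, qGreedySet f t x A →
        (∃ k, A.card = n k) → q (qproj e f A x) ≤ C₄ := by
  intro x
  have hα := h.hα
  have hc := h.hc1
  have hqx := h.hq0 x
  set M := α * (q x + 1) with hM
  have hM0 : 0 < M := by positivity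
  have ex : ∀ k, ∃ A : Finset ℕ, (qGreedySet f t x A ∧ A.card = n k) ∧
      ((∃ A' : Finset ℕ, (qGreedySet f t x A' ∧ A'.card = n k) ∧ M < q (qproj e f A' x)) →
        M < q (qproj e f A x)) := by
    intro k
    by_cases hk : ∃ A' : Finset ℕ, (qGreedySet f t x A' ∧ A'.card = n k) ∧ M < q (qproj e f A' x)
    · obtain ⟨A', h1, h2⟩ := hk
      exact ⟨A', h1, fun _ => h2⟩
    · obtain ⟨D, -, h2, h3⟩ := h.extend ht0 ht1 x ∅ (by intro i hi; simp at hi) (n k)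
      rw [Finset.empty_union] at h3
      exact ⟨D, ⟨h3, h2⟩, fun hh => absurd hh hk⟩
  choose A hA hA' using ex
  obtain ⟨K, hK⟩ := H x A hA 1 one_pos
  have hKn := h.K_nonneg (n K)
  refine ⟨max M ((n K : ℝ) * α ^ (n K) * c * c * q x), lt_max_of_lt_left hM0, ?_⟩
  rintro G hG ⟨k, hk⟩
  by_cases hkK : K ≤ k
  · refine le_max_of_le_left ?_
    by_contra hcon
    push Not at hcon
    have h1 := hA' k ⟨G, ⟨hG, hk⟩, hcon⟩
    have h2 := h.q_sub x (x - qproj e f (A k) x)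
    rw [sub_sub_cancel] at h2
    have h3 : α * (q x + q (x - qproj e f (A k) x)) ≤ α * (q x + 1) := by
      gcongr
      exact hK k hkK
    linarith
  · refine le_max_of_le_right ?_
    refine (h.proj_bound _ _).trans ?_
    have := h.K_mono (show G.card ≤ n K by rw [hk]; exact hn.monotone (by omega))
    gcongr

set_option maxHeartbeats 1000000 in
/-- gliding hump step -/
lemma hump (h : QB q α e f c) {t : ℝ} (ht0 : 0 < t) (ht1 : t ≤ 1) (n : ℕ → ℕ)
    (H : ¬ ∃ (m : ℕ) (C₃ : ℝ), 0 < C₃ ∧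
        ∀ x ∈ Submodule.span ℝ (Set.range e), (∀ i, f i x ≠ 0 → m < i) →
          ∀ A : Finset ℕ, qGreedySet f t x A → (∃ k, A.card = n k) →
            q (qproj e f A x) ≤ C₃ * q x)
    (y : X) (hy : y ∈ Submodule.span ℝ (Set.range e)) (m : ℕ) (hm : ∀ i, f i y ≠ 0 → i ≤ m)
    (ε : ℝ) (hε : 0 < ε) (N : ℝ) :
    ∃ y' ∈ Submodule.span ℝ (Set.range e), ∃ G : Finset ℕ, q (y' - y) ≤ ε ∧
      (∀ i ≤ m, f i y' = f i y) ∧ qGreedySet f t y' G ∧ (∃ k, G.card = n k) ∧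
      (∀ i ∈ G, f i y' ≠ 0) ∧ N ≤ q (qproj e f G y') := by
  have hα := h.hα
  have hc := h.hc1
  obtain ⟨F, hF, hFy⟩ := h.span_supp hy
  obtain ⟨η, hη, hηF⟩ := exists_eta F y fun i hi => (hF i).mp hi
  set ε' := min ε (η / c) with hε'def
  have hε' : 0 < ε' := lt_min hε (by positivity)
  set K := (F.card : ℝ) * α ^ F.card * c * c with hKdef
  have hK : 0 ≤ K := by positivity
  have hqy := h.hq0 y
  set C := 1 + K + α * (|N| + α * (K * ε' + q y)) / ε' with hCdef
  have hC2 : 0 ≤ α * (|N| + α * (K * ε' + q y)) / ε' := by positivity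
  have hC0 : 0 < C := by positivity
  push Not at H
  obtain ⟨z₀, hz₀, hz₀m, A, hA₀, hk, hz₀q⟩ := H m C hC0
  have hz₀pos : 0 < q z₀ := by
    rcases (h.hq0 z₀).lt_or_eq with h1 | h1
    · exact h1
    · have := h.proj_bound z₀ A
      rw [← h1] at this hz₀q
      simp only [mul_zero] at this hz₀q
      linarith
  set s := ε' / q z₀ with hs
  have hs0 : 0 < s := by positivity
  set z := s • z₀ with hz
  have hzq : q z = ε' := by
    rw [hz, h.hqs, abs_of_pos hs0, hs]; field_simp
  have hfz : ∀ i, f i z = s * f i z₀ := fun i => by rw [hz, map_smul, smul_eq_mul]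
  have hzs : z ∈ Submodule.span ℝ (Set.range e) := Submodule.smul_mem _ _ hz₀
  have hzm : ∀ i ≤ m, f i z = 0 := by
    intro i hi
    by_contra h0
    have := hz₀m i (by rintro h1; rw [hfz, h1, mul_zero] at h0; exact h0 rfl)
    omega
  have hA : qGreedySet f t z A := by
    intro i hi j hj
    have := hA₀ i hi j hj
    rw [hfz, hfz, abs_mul, abs_mul, abs_of_pos hs0]
    nlinarith
  have hzP : C * ε' < q (qproj e f A z) := by
    rw [hz, proj_smul, h.hqs, abs_of_pos hs0]
    have : C * ε' = s * (C * q z₀) := by rw [hs]; field_simp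
    rw [this]
    gcongr
  -- A is contained in the support of z
  have hAz : ∀ i ∈ A, f i z ≠ 0 := by
    intro i hi h0
    obtain ⟨Z, hZ, hZz⟩ := h.span_supp hzs
    have hZA : Z ⊆ A := by
      intro j hj
      by_contra hjA
      have h1 := hA i hi j hjA
      rw [h0, abs_zero] at h1
      have h2 := abs_pos.mpr ((hZ j).mp hj)
      nlinarith
    have : qproj e f A z = z := by
      rw [← proj_mono Z A hZA z, hZz]
      intro j _ hj
      by_contra h1
      exact hj ((hZ j).mpr h1)
    rw [this, hzq] at hzP
    have : 1 ≤ C := by linarith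
    nlinarith
  have hcard : F.card ≤ A.card := by
    by_contra hcon
    push Not at hcon
    have h1 := h.proj_bound z A
    have h2 := h.K_mono hcon.le
    rw [hzq] at h1
    have : K ≤ C := by linarith
    rw [← hKdef] at h2
    nlinarith
  obtain ⟨L, hLA, hLc, hL⟩ := small_subset (f := f) z A F.card hcard
  have hFm : ∀ i ∈ F, i ≤ m := fun i hi => hm i ((hF i).mp hi)
  have hAm : ∀ i ∈ A, m < i := by
    intro i hi
    by_contra h1
    exact hAz i hi (hzm i (by omega))
  have hy0 : ∀ i ∉ F, f i y = 0 := by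
    intro i hi
    by_contra h1
    exact hi ((hF i).mpr h1)
  have hFA : Disjoint F A := by
    rw [Finset.disjoint_left]
    intro i h1 h2
    have := hFm i h1
    have := hAm i h2
    omega
  have hdis : Disjoint F (A \ L) := hFA.mono_right Finset.sdiff_subset
  have hfF : ∀ i ∈ F, f i (y + z) = f i y := by
    intro i hi
    rw [map_add, hzm i (hFm i hi), add_zero]
  have hfnF : ∀ i ∉ F, f i (y + z) = f i z := by
    intro i hi
    rw [map_add, hy0 i hi, zero_add]
  refine ⟨y + z, Submodule.add_mem _ hy hzs, F ∪ (A \ L), ?_, ?_, ?_, ?_, ?_, ?_⟩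
  · rw [add_sub_cancel_left, hzq]
    exact min_le_left _ _
  · intro i hi
    rw [map_add, hzm i hi, add_zero]
  · intro i hi j hj
    rw [Finset.mem_union, not_or] at hj
    rw [hfnF j hj.1]
    rw [Finset.mem_union] at hi
    rcases hi with hi | hi
    · rw [hfF i hi]
      have h1 := h.hfc j z
      have h2 := hηF i hi
      have h3 : c * q z ≤ η := by
        rw [hzq]
        have : ε' ≤ η / c := min_le_right _ _
        rw [le_div_iff₀ (by positivity)] at this
        linarith
      nlinarith [abs_nonneg (f j z)]
    · have hiF : i ∉ F := Finset.disjoint_right.mp hdis hi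
      rw [hfnF i hiF]
      rw [Finset.mem_sdiff] at hi
      by_cases hjA : j ∈ A
      · have hjL : j ∈ L := by
          by_contra hjL
          exact hj.2 (Finset.mem_sdiff.mpr ⟨hjA, hjL⟩)
        have := hL j hjL i hi.1 hi.2
        nlinarith [abs_nonneg (f j z)]
      · exact hA i hi.1 j hjA
  · obtain ⟨k, hk⟩ := hk
    refine ⟨k, ?_⟩
    rw [Finset.card_union_of_disjoint hdis, Finset.card_sdiff_of_subset hLA]
    omega
  · intro i hi
    rw [Finset.mem_union] at hi
    rcases hi with hi | hi
    · rw [hfF i hi]; exact (hF i).mp hi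
    · rw [hfnF i (Finset.disjoint_right.mp hdis hi)]
      exact hAz i (Finset.mem_sdiff.mp hi).1
  · have e1 : qproj e f (F ∪ (A \ L)) (y + z) = y + qproj e f (A \ L) z := by
      have : qproj e f (F ∪ (A \ L)) (y + z) = qproj e f F (y + z) + qproj e f (A \ L) (y + z) := by
        simp only [qproj]
        rw [Finset.sum_union hdis]
      rw [this, proj_congr F _ y hfF, hFy,
        proj_congr (A \ L) _ z fun i hi => hfnF i (Finset.disjoint_right.mp hdis hi)]
    have e2 : qproj e f A z = qproj e f (A \ L) z + qproj e f L z := by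
      simp only [qproj]
      rw [Finset.sum_sdiff hLA]
    have e3 : qproj e f A z = qproj e f (F ∪ (A \ L)) (y + z) + (qproj e f L z - y) := by
      rw [e1, e2]; abel
    have b1 : q (qproj e f L z - y) ≤ α * (K * ε' + q y) := by
      refine (h.q_sub _ _).trans ?_
      gcongr
      have := h.proj_bound z L
      rw [hLc, hzq] at this
      exact this
    have b2 : q (qproj e f A z) ≤
        α * (q (qproj e f (F ∪ (A \ L)) (y + z)) + α * (K * ε' + q y)) := by
      rw [e3]
      refine (h.hqa _ _).trans ?_
      gcongr
    have b3 : α * (|N| + α * (K * ε' + q y)) ≤ C * ε' := by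
      have : C * ε' = (1 + K) * ε' + α * (|N| + α * (K * ε' + q y)) := by
        rw [hCdef, add_mul, div_mul_cancel₀ _ hε'.ne']
      rw [this]
      have : 0 ≤ (1 + K) * ε' := by positivity
      linarith
    have b4 := lt_of_mul_lt_mul_left ((b3.trans_lt hzP).trans_le b2) (by linarith)
    have := le_abs_self N
    linarith

set_option maxHeartbeats 1000000 in
/-- (iv) → (iii) -/
lemma four_three (h : QB q α e f c) {t : ℝ} (ht0 : 0 < t) (ht1 : t ≤ 1) (n : ℕ → ℕ)
    (hcomplete : ∀ u : ℕ → X,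
      (∀ ε : ℝ, 0 < ε → ∃ N, ∀ p ≥ N, ∀ r ≥ N, q (u p - u r) ≤ ε) →
      ∃ x : X, ∀ ε : ℝ, 0 < ε → ∃ N, ∀ p ≥ N, q (u p - x) ≤ ε)
    (H4 : ∀ x : X, ∃ C₄ : ℝ, 0 < C₄ ∧ ∀ A : Finset ℕ, qGreedySet f t x A →
        (∃ k, A.card = n k) → q (qproj e f A x) ≤ C₄) :
    ∃ (m : ℕ) (C₃ : ℝ), 0 < C₃ ∧
        ∀ x ∈ Submodule.span ℝ (Set.range e), (∀ i, f i x ≠ 0 → m < i) →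
          ∀ A : Finset ℕ, qGreedySet f t x A → (∃ k, A.card = n k) →
            q (qproj e f A x) ≤ C₃ * q x := by
  by_contra H
  have hα := h.hα
  have hc := h.hc1
  -- states: (y, δ, m)
  let P : X × ℝ × ℕ → Prop := fun s =>
    s.1 ∈ Submodule.span ℝ (Set.range e) ∧ 0 < s.2.1 ∧ ∀ i, f i s.1 ≠ 0 → i ≤ s.2.2
  have step : ∀ (j : ℕ) (s : {s // P s}), ∃ s' : {s // P s},
      q (s'.1.1 - s.1.1) ≤ s.1.2.1 ∧ s'.1.2.1 ≤ s.1.2.1 / (2 * α) ∧ s.1.2.2 ≤ s'.1.2.2 ∧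
      (∀ i ≤ s.1.2.2, f i s'.1.1 = f i s.1.1) ∧
      ∃ G : Finset ℕ, qGreedySet f t s'.1.1 G ∧ (∃ k, G.card = n k) ∧
        (∀ i ∈ G, c * (3 * α ^ 2 * s'.1.2.1) ≤ |f i s'.1.1|) ∧ (∀ i ∈ G, i ≤ s'.1.2.2) ∧
        (j : ℝ) ≤ q (qproj e f G s'.1.1) := by
    rintro j ⟨⟨y, δ, m⟩, hy, hδ, hm⟩
    simp only at hy hδ hm
    obtain ⟨y', hy', G, h1, h2, h3, h4, h5, h6⟩ := h.hump ht0 ht1 n H y hy m hm δ hδ j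
    obtain ⟨η, hη, hηG⟩ := exists_eta G y' h5
    obtain ⟨δ₁, hδ₁, hδ₁η⟩ := exists_small (c * (3 * α ^ 2)) η (by positivity) hη
    obtain ⟨F, hF, -⟩ := h.span_supp hy'
    have hδ' : 0 < min δ₁ (δ / (2 * α)) := lt_min hδ₁ (by positivity)
    refine ⟨⟨(y', min δ₁ (δ / (2 * α)), max m (F.sup id)), hy', hδ', ?_⟩, h1, min_le_right _ _,
      le_max_left _ _, h2, G, h3, h4, ?_, ?_, h6⟩
    · intro i hi
      exact le_max_of_le_right (Finset.le_sup (f := id) ((hF i).mpr hi))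
    · intro i hi
      refine le_trans ?_ (hηG i hi)
      refine le_trans ?_ hδ₁η
      simp only
      rw [← mul_assoc]
      gcongr
      exact min_le_left _ _
    · intro i hi
      exact le_max_of_le_right (Finset.le_sup (f := id) ((hF i).mpr (h5 i hi)))
  choose nxt hn1 hn2 hn3 hn4 G hG1 hG2 hG3 hG4 hG5 using step
  let s : ℕ → {s // P s} := fun j => Nat.rec
    ⟨(0, 1, 0), Submodule.zero_mem _, one_pos, by simp⟩ (fun j s => nxt j s) j
  have hs : ∀ j, s (j + 1) = nxt j (s j) := fun j => rfl
  set y : ℕ → X := fun j => (s j).1.1 with hydef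
  set δ : ℕ → ℝ := fun j => (s j).1.2.1 with hδdef
  set m : ℕ → ℕ := fun j => (s j).1.2.2 with hmdef
  have hδpos : ∀ j, 0 < δ j := fun j => (s j).2.2.1
  have a1 : ∀ j, q (y (j + 1) - y j) ≤ δ j := fun j => hn1 j (s j)
  have a2 : ∀ j, δ (j + 1) ≤ δ j / (2 * α) := fun j => hn2 j (s j)
  have a3 : Monotone m := monotone_nat_of_le_succ fun j => hn3 j (s j)
  have a4 : ∀ j, ∀ i ≤ m j, f i (y (j + 1)) = f i (y j) := fun j => hn4 j (s j)
  have b : ∀ r j, q (y (j + r) - y j) ≤ 2 * α * δ j := by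
    intro r
    induction r with
    | zero =>
      intro j
      have := hδpos j
      simp only [add_zero, sub_self, h.q_zero]
      positivity
    | succ r ih =>
      intro j
      have h1 := ih (j + 1)
      have h2 := a2 j
      rw [le_div_iff₀ (by positivity)] at h2
      have e1 : y (j + (r + 1)) - y j = (y (j + 1) - y j) + (y (j + 1 + r) - y (j + 1)) := by
        rw [show j + (r + 1) = j + 1 + r by ring]; abel
      rw [e1]
      calc _ ≤ α * (δ j + δ j) := by
            refine (h.hqa _ _).trans ?_
            gcongr
            · exact a1 j
            · linarith
        _ = _ := by ring
  have hδlim : ∀ j, δ j ≤ (1 / 2) ^ j := by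
    intro j
    induction j with
    | zero => simp [hδdef, s]
    | succ j ih =>
      refine (a2 j).trans ?_
      rw [div_le_iff₀ (by positivity), pow_succ]
      have : (0:ℝ) < (1 / 2) ^ j := by positivity
      nlinarith
  obtain ⟨x, hx⟩ := hcomplete y (by
    intro ε hε
    obtain ⟨θ, hθ, hθε⟩ := exists_small (α * (4 * α)) ε (by positivity) hε
    obtain ⟨N, hN⟩ := exists_pow_lt_of_lt_one hθ (show (1 / 2 : ℝ) < 1 by norm_num)
    refine ⟨N, fun p hp r hr => ?_⟩
    obtain ⟨p, rfl⟩ := Nat.exists_eq_add_of_le hp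
    obtain ⟨r, rfl⟩ := Nat.exists_eq_add_of_le hr
    have e1 : y (N + p) - y (N + r) = (y (N + p) - y N) - (y (N + r) - y N) := by abel
    rw [e1]
    have hd : δ N ≤ θ := (hδlim N).trans hN.le
    calc _ ≤ α * (2 * α * δ N + 2 * α * δ N) := by
          refine (h.q_sub _ _).trans ?_
          gcongr
          · exact b p N
          · exact b r N
      _ = α * (4 * α) * δ N := by ring
      _ ≤ α * (4 * α) * θ := by gcongr
      _ ≤ ε := hθε)
  have d1 : ∀ j, q (x - y j) ≤ 3 * α ^ 2 * δ j := by
    intro j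
    have hp := hδpos j
    obtain ⟨N, hN⟩ := hx (δ j) hp
    have h1 := hN (j + N) (by omega)
    have h2 := b N j
    have e1 : x - y j = (y (j + N) - y j) - (y (j + N) - x) := by abel
    rw [e1]
    calc _ ≤ α * (2 * α * δ j + α * δ j) := by
          refine (h.q_sub _ _).trans ?_
          gcongr
          nlinarith
      _ = _ := by ring
  have d2 : ∀ j r, ∀ i ≤ m j, f i (y (j + r)) = f i (y j) := by
    intro j r i hi
    induction r with
    | zero => rfl
    | succ r ih =>
      rw [← ih]
      exact a4 (j + r) i (hi.trans (a3 (by omega)))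
  have d3 : ∀ j, ∀ i ≤ m j, f i x = f i (y j) := by
    intro j i hi
    by_contra hne
    have hpos : 0 < |f i x - f i (y j)| := abs_pos.mpr (sub_ne_zero.mpr hne)
    obtain ⟨θ, hθ, hθε⟩ := exists_small c (|f i x - f i (y j)| / 2) (by positivity) (by positivity)
    obtain ⟨N, hN⟩ := hx θ hθ
    have h1 := h.hfc i (y (j + N) - x)
    rw [map_sub, d2 j N i hi, abs_sub_comm] at h1
    have h2 : c * q (y (j + N) - x) ≤ c * θ := by
      gcongr
      exact hN _ (by omega)
    linarith
  obtain ⟨C, hC, HC⟩ := H4 x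
  obtain ⟨j, hj⟩ := exists_nat_gt C
  have g1 : qGreedySet f t (y (j + 1)) (G j (s j)) := hG1 j (s j)
  have g3 : ∀ i ∈ G j (s j), c * (3 * α ^ 2 * δ (j + 1)) ≤ |f i (y (j + 1))| := hG3 j (s j)
  have g4 : ∀ i ∈ G j (s j), i ≤ m (j + 1) := hG4 j (s j)
  have g5 : (j : ℝ) ≤ q (qproj e f (G j (s j)) (y (j + 1))) := hG5 j (s j)
  have hgr : qGreedySet f t x (G j (s j)) := by
    intro i hi l hl
    rw [d3 (j + 1) i (g4 i hi)]
    by_cases hlm : l ≤ m (j + 1)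
    · rw [d3 (j + 1) l hlm]
      exact g1 i hi l hl
    · have h0 : f l (y (j + 1)) = 0 := by
        by_contra h0
        exact hlm ((s (j + 1)).2.2.2 l h0)
      have h1 := h.hfc l (x - y (j + 1))
      rw [map_sub, h0, sub_zero] at h1
      have h2 : c * q (x - y (j + 1)) ≤ c * (3 * α ^ 2 * δ (j + 1)) := by
        have := d1 (j + 1)
        exact mul_le_mul_of_nonneg_left this (by linarith)
      have h3 := g3 i hi
      nlinarith [abs_nonneg (f l x)]
  have := HC _ hgr (hG2 j (s j))
  rw [proj_congr _ x (y (j + 1)) fun i hi => d3 (j + 1) i (g4 i hi)] at this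
  linarith

end QB

/-- Characterization of `n`-`t`-quasi-greediness of a semi-normalized
Markushevich basis of a quasi-Banach space: uniform boundedness of the greedy
projections of cardinalities in `n`, its restriction to finitely supported
vectors, its restriction to finitely supported vectors supported beyond some
`m`, pointwise boundedness, and norm convergence of all weak greedy sums of
orders `n_k`, are all equivalent. -/
theorem stmt_13 {X : Type*} [AddCommGroup X] [Module ℝ X]
    (q : X → ℝ) (α : ℝ) (hα : 1 ≤ α)
    (hq0 : ∀ x : X, 0 ≤ q x) (hqz : ∀ x : X, q x = 0 ↔ x = 0)
    (hqs : ∀ (a : ℝ) (x : X), q (a • x) = |a| * q x)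
    (hqa : ∀ x y : X, q (x + y) ≤ α * (q x + q y))
    (hcomplete : ∀ u : ℕ → X,
      (∀ ε : ℝ, 0 < ε → ∃ N, ∀ p ≥ N, ∀ r ≥ N, q (u p - u r) ≤ ε) →
      ∃ x : X, ∀ ε : ℝ, 0 < ε → ∃ N, ∀ p ≥ N, q (u p - x) ≤ ε)
    (e : ℕ → X) (f : ℕ → X →ₗ[ℝ] ℝ) (fn : ℕ → ℝ)
    (hfn0 : ∀ i, 0 ≤ fn i) (hfb : ∀ (i : ℕ) (x : X), |f i x| ≤ fn i * q x)
    (hbio : ∀ k i, f k (e i) = if k = i then 1 else 0)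
    (c : ℝ) (hc : ∀ i, (1 + q (e i)) * (1 + fn i) ≤ c)
    (hdense : ∀ x : X, ∀ ε : ℝ, 0 < ε →
      ∃ y ∈ Submodule.span ℝ (Set.range e), q (x - y) ≤ ε)
    (t : ℝ) (ht0 : 0 < t) (ht1 : t ≤ 1)
    (n : ℕ → ℕ) (hn : StrictMono n) (hnpos : ∀ k, 0 < n k) :
    List.TFAE [
      -- (i) uniform bound on the whole space
      (∃ C₁ : ℝ, 0 < C₁ ∧ ∀ (x : X) (A : Finset ℕ), qGreedySet f t x A →
        (∃ k, A.card = n k) → q (qproj e f A x) ≤ C₁ * q x),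
      -- (ii) uniform bound on finitely supported vectors
      (∃ C₂ : ℝ, 0 < C₂ ∧ ∀ x ∈ Submodule.span ℝ (Set.range e), ∀ A : Finset ℕ,
        qGreedySet f t x A → (∃ k, A.card = n k) → q (qproj e f A x) ≤ C₂ * q x),
      -- (iii) uniform bound on finitely supported vectors supported beyond `m`
      (∃ (m : ℕ) (C₃ : ℝ), 0 < C₃ ∧
        ∀ x ∈ Submodule.span ℝ (Set.range e), (∀ i, f i x ≠ 0 → m < i) →
          ∀ A : Finset ℕ, qGreedySet f t x A → (∃ k, A.card = n k) →
            q (qproj e f A x) ≤ C₃ * q x),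
      -- (iv) pointwise boundedness
      (∀ x : X, ∃ C₄ : ℝ, 0 < C₄ ∧ ∀ A : Finset ℕ, qGreedySet f t x A →
        (∃ k, A.card = n k) → q (qproj e f A x) ≤ C₄),
      -- (v) convergence of all weak greedy sums of orders `n_k`
      (∀ (x : X) (A : ℕ → Finset ℕ),
        (∀ k, qGreedySet f t x (A k) ∧ (A k).card = n k) →
        ∀ ε : ℝ, 0 < ε → ∃ K, ∀ k ≥ K, q (x - qproj e f (A k) x) ≤ ε)
    ] := by
  have h : QB q α e f c := by
    have hb : ∀ i, q (e i) ≤ c ∧ fn i ≤ c ∧ 1 ≤ c := by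
      intro i
      have h1 := hc i
      have h2 := hq0 (e i)
      have h3 := hfn0 i
      have h4 := mul_nonneg h2 h3
      refine ⟨?_, ?_, ?_⟩ <;> nlinarith
    refine ⟨hα, hq0, hqs, hqa, fun i x => (hfb i x).trans ?_, fun i => (hb i).1, (hb 0).2.2,
      hbio, hdense⟩
    exact mul_le_mul_of_nonneg_right (hb i).2.1 (hq0 x)
  tfae_have 1 → 5 := h.one_five ht0 ht1 n hn
  tfae_have 5 → 4 := h.five_four ht0 ht1 n hn
  tfae_have 4 → 3 := h.four_three ht0 ht1 n hcomplete
  tfae_have 3 → 2 := h.three_two ht0 ht1 n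
  tfae_have 2 → 1 := h.two_one ht0 ht1 n
  tfae_finish
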